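/- Let L₁, L₂ > 0, c > 0, λ ≥ 0, D > 0, c̃ > 0 and κ ≠ 0 be real numbers. For i = 1,2 let ρᵢ, mᵢ : ℝ × ℝ → ℝ be continuously differentiable with ρᵢ(x,t) > 0 on [0,Lᵢ], satisfying the ISO2b equations ∂ₜρᵢ + ∂ₓmᵢ = 0 and ∂ₜmᵢ + ∂ₓ(c²ρᵢ) = −(λ/(2D))·mᵢ·|mᵢ/ρᵢ| for all x ∈ [0,Lᵢ] and all t. Assume the FC/AV compressor coupling conditions hold for all t: c²ρ₂(0,t) = c̃·c²ρ₁(L₁,t) and m₁(L₁,t) = c̃^(−1/κ)·m₂(0,t). Let H(t) = ∫₀^{L₁} (c²ρ₁²/2 + m₁²/2) dx + ∫₀^{L₂} (c²ρ₂²/2 + m₂²/2) dx. Then for every t, H'(t) = c²ρ₁(0,t)·m₁(0,t) − c²ρ₂(L₂,t)·m₂(L₂,t) + (c̃ − c̃^(−1/κ))·c²ρ₁(L₁,t)·m₂(0,t) − ∫₀^{L₁} (λ/(2D))·|m₁/ρ₁|·m₁² dx − ∫₀^{L₂} (λ/(2D))·|m₂/ρ₂|·m₂² dx. -/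

import Mathlib

open intervalIntegral

theorem ContDiff.hasDerivAt_snd_apply {f : ℝ × ℝ → ℝ} (hf : ContDiff ℝ 1 f) (x t : ℝ) :
    HasDerivAt (fun τ => f (x, τ)) (fderiv ℝ f (x, t) (0, 1)) t :=
  (hf.differentiable one_ne_zero (x, t)).hasFDerivAt.comp_hasDerivAt t
    ((hasDerivAt_const t x).prodMk (hasDerivAt_id t))

theorem ContDiff.hasDerivAt_fst_apply {f : ℝ × ℝ → ℝ} (hf : ContDiff ℝ 1 f) (x t : ℝ) :
    HasDerivAt (fun ξ => f (ξ, t)) (fderiv ℝ f (x, t) (1, 0)) x :=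
  (hf.differentiable one_ne_zero (x, t)).hasFDerivAt.comp_hasDerivAt
    (f := fun ξ : ℝ => (ξ, t)) x ((hasDerivAt_id x).prodMk (hasDerivAt_const x t))

theorem ContDiff.continuous_fderiv_apply_const {f : ℝ × ℝ → ℝ} (hf : ContDiff ℝ 1 f)
    (v : ℝ × ℝ) : Continuous fun p => fderiv ℝ f p v :=
  (hf.continuous_fderiv one_ne_zero).clm_apply continuous_const

/-- Differentiation under the integral sign for a continuously differentiable integrand. -/
theorem ContDiff.hasDerivAt_intervalIntegral {f : ℝ × ℝ → ℝ} (hf : ContDiff ℝ 1 f) (a b t : ℝ) :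
    HasDerivAt (fun τ => ∫ x in a..b, f (x, τ)) (∫ x in a..b, fderiv ℝ f (x, t) (0, 1)) t := by
  have hcont : ∀ τ, Continuous fun x => f (x, τ) := fun τ =>
    hf.continuous.comp (by fun_prop : Continuous fun x : ℝ => (x, τ))
  have hcont' := hf.continuous_fderiv_apply_const (0, 1)
  obtain ⟨C, hC⟩ := (isCompact_uIcc (a := a) (b := b)).prod (isCompact_closedBall t 1)
    |>.exists_bound_of_continuousOn hcont'.continuousOn
  refine (hasDerivAt_integral_of_dominated_loc_of_deriv_le
    (F := fun τ x => f (x, τ)) (F' := fun τ x => fderiv ℝ f (x, τ) (0, 1))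
    (bound := fun _ => C) (Metric.closedBall_mem_nhds t one_pos)
    (Filter.Eventually.of_forall fun τ => (hcont τ).aestronglyMeasurable)
    ((hcont t).intervalIntegrable a b)
    (hcont'.comp (by fun_prop : Continuous fun x : ℝ => (x, t))).aestronglyMeasurable
    (Filter.Eventually.of_forall fun x hx τ hτ => hC (x, τ) ⟨Set.uIoc_subset_uIcc hx, hτ⟩)
    intervalIntegrable_const
    (Filter.Eventually.of_forall fun x _ τ _ => hf.hasDerivAt_snd_apply x τ)).2

/-- Energy balance for a single ISO2b pipe. -/
theorem iso2b_pipe_energy_balance {L c lam D : ℝ} (hL : 0 ≤ L) {ρ m : ℝ × ℝ → ℝ}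
    (hρ : ContDiff ℝ 1 ρ) (hm : ContDiff ℝ 1 m) (t : ℝ)
    (hmass : ∀ x ∈ Set.Icc (0 : ℝ) L,
      deriv (fun τ => ρ (x, τ)) t + deriv (fun ξ => m (ξ, t)) x = 0)
    (hmom : ∀ x ∈ Set.Icc (0 : ℝ) L,
      deriv (fun τ => m (x, τ)) t + deriv (fun ξ => c ^ 2 * ρ (ξ, t)) x =
        -(lam / (2 * D)) * m (x, t) * |m (x, t) / ρ (x, t)|) :
    HasDerivAt (fun τ => ∫ x in (0 : ℝ)..L, (c ^ 2 * ρ (x, τ) ^ 2 / 2 + m (x, τ) ^ 2 / 2))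
      (c ^ 2 * ρ (0, t) * m (0, t) - c ^ 2 * ρ (L, t) * m (L, t)
        - ∫ x in (0 : ℝ)..L, lam / (2 * D) * |m (x, t) / ρ (x, t)| * m (x, t) ^ 2) t := by
  let e : ℝ × ℝ → ℝ := fun p => c ^ 2 * ρ p ^ 2 / 2 + m p ^ 2 / 2
  let q : ℝ × ℝ → ℝ := fun p => c ^ 2 * ρ p * m p
  have he : ContDiff ℝ 1 e := by fun_prop
  have hq : ContDiff ℝ 1 q := by fun_prop
  have hslice : Continuous fun x : ℝ => (x, t) := by fun_prop
  have het := ((he.continuous_fderiv_apply_const (0, 1)).comp hslice).intervalIntegrable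
    (μ := MeasureTheory.volume) 0 L
  have hqx := ((hq.continuous_fderiv_apply_const (1, 0)).comp hslice).intervalIntegrable
    (μ := MeasureTheory.volume) 0 L
  have hflux : ∫ x in (0 : ℝ)..L, fderiv ℝ q (x, t) (1, 0) = q (L, t) - q (0, t) :=
    integral_eq_sub_of_hasDerivAt (fun x _ => hq.hasDerivAt_fst_apply x t) hqx
  have hlocal : ∀ x ∈ Set.uIcc (0 : ℝ) L,
      fderiv ℝ e (x, t) (0, 1) + fderiv ℝ q (x, t) (1, 0) =
        -(lam / (2 * D) * |m (x, t) / ρ (x, t)| * m (x, t) ^ 2) := by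
    intro x hx
    rw [Set.uIcc_of_le hL] at hx
    have hmass' := hmass x hx
    have hmom' := hmom x hx
    rw [(hρ.hasDerivAt_snd_apply x t).deriv, (hm.hasDerivAt_fst_apply x t).deriv] at hmass'
    rw [(hm.hasDerivAt_snd_apply x t).deriv,
      ((hρ.hasDerivAt_fst_apply x t).const_mul (c ^ 2)).deriv] at hmom'
    have hetx := (he.hasDerivAt_snd_apply x t).unique
      (((((hρ.hasDerivAt_snd_apply x t).pow 2).const_mul (c ^ 2)).div_const 2).add
        (((hm.hasDerivAt_snd_apply x t).pow 2).div_const 2))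
    have hqtx := (hq.hasDerivAt_fst_apply x t).unique
      (((hρ.hasDerivAt_fst_apply x t).const_mul (c ^ 2)).mul (hm.hasDerivAt_fst_apply x t))
    rw [hetx, hqtx]
    norm_num
    linear_combination c ^ 2 * ρ (x, t) * hmass' + m (x, t) * hmom'
  have hsum := integral_congr (μ := MeasureTheory.volume) hlocal
  rw [integral_neg] at hsum
  have hadd := integral_add het hqx
  simp only [Function.comp_apply] at hadd
  rw [hadd, hflux] at hsum
  refine (he.hasDerivAt_intervalIntegral 0 L t).congr_deriv ?_
  linear_combination hsum

/-- Energy balance for two ISO2b pipes coupled by a compressor in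
framework FC (prescribed compression ratio `ct`) under assumption AV
(constant velocity across the compressor). -/
theorem fc_av_two_pipe_energy_balance
    (L₁ L₂ c lam D : ℝ) (hL₁ : 0 < L₁) (hL₂ : 0 < L₂) (hc : 0 < c)
    (hlam : 0 ≤ lam) (hD : 0 < D) (ct κ : ℝ) (hct : 0 < ct) (hκ : κ ≠ 0)
    (ρ₁ m₁ ρ₂ m₂ : ℝ × ℝ → ℝ)
    (hρ₁ : ContDiff ℝ 1 ρ₁) (hm₁ : ContDiff ℝ 1 m₁)
    (hρ₂ : ContDiff ℝ 1 ρ₂) (hm₂ : ContDiff ℝ 1 m₂)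
    (hρ₁pos : ∀ x ∈ Set.Icc (0 : ℝ) L₁, ∀ t : ℝ, 0 < ρ₁ (x, t))
    (hρ₂pos : ∀ x ∈ Set.Icc (0 : ℝ) L₂, ∀ t : ℝ, 0 < ρ₂ (x, t))
    (hmass₁ : ∀ x ∈ Set.Icc (0 : ℝ) L₁, ∀ t : ℝ,
      deriv (fun τ => ρ₁ (x, τ)) t + deriv (fun ξ => m₁ (ξ, t)) x = 0)
    (hmom₁ : ∀ x ∈ Set.Icc (0 : ℝ) L₁, ∀ t : ℝ,
      deriv (fun τ => m₁ (x, τ)) t + deriv (fun ξ => c ^ 2 * ρ₁ (ξ, t)) x =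
        -(lam / (2 * D)) * m₁ (x, t) * |m₁ (x, t) / ρ₁ (x, t)|)
    (hmass₂ : ∀ x ∈ Set.Icc (0 : ℝ) L₂, ∀ t : ℝ,
      deriv (fun τ => ρ₂ (x, τ)) t + deriv (fun ξ => m₂ (ξ, t)) x = 0)
    (hmom₂ : ∀ x ∈ Set.Icc (0 : ℝ) L₂, ∀ t : ℝ,
      deriv (fun τ => m₂ (x, τ)) t + deriv (fun ξ => c ^ 2 * ρ₂ (ξ, t)) x =
        -(lam / (2 * D)) * m₂ (x, t) * |m₂ (x, t) / ρ₂ (x, t)|)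
    (hpressure : ∀ t : ℝ, c ^ 2 * ρ₂ (0, t) = ct * (c ^ 2 * ρ₁ (L₁, t)))
    (hmomentum : ∀ t : ℝ, m₁ (L₁, t) = ct ^ (-(1 / κ)) * m₂ (0, t))
    (H : ℝ → ℝ)
    (hH : ∀ t : ℝ, H t =
      (∫ x in (0 : ℝ)..L₁, (c ^ 2 * ρ₁ (x, t) ^ 2 / 2 + m₁ (x, t) ^ 2 / 2)) +
      ∫ x in (0 : ℝ)..L₂, (c ^ 2 * ρ₂ (x, t) ^ 2 / 2 + m₂ (x, t) ^ 2 / 2)) :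
    ∀ t : ℝ, HasDerivAt H
      (c ^ 2 * ρ₁ (0, t) * m₁ (0, t) - c ^ 2 * ρ₂ (L₂, t) * m₂ (L₂, t)
        + (ct - ct ^ (-(1 / κ))) * (c ^ 2 * ρ₁ (L₁, t)) * m₂ (0, t)
        - (∫ x in (0 : ℝ)..L₁,
            lam / (2 * D) * |m₁ (x, t) / ρ₁ (x, t)| * m₁ (x, t) ^ 2)
        - ∫ x in (0 : ℝ)..L₂,
            lam / (2 * D) * |m₂ (x, t) / ρ₂ (x, t)| * m₂ (x, t) ^ 2) t := by
  intro t
  have h₁ := iso2b_pipe_energy_balance hL₁.le hρ₁ hm₁ t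
    (fun x hx => hmass₁ x hx t) (fun x hx => hmom₁ x hx t)
  have h₂ := iso2b_pipe_energy_balance hL₂.le hρ₂ hm₂ t
    (fun x hx => hmass₂ x hx t) (fun x hx => hmom₂ x hx t)
  rw [funext hH]
  refine (h₁.add h₂).congr_deriv ?_
  linear_combination m₂ (0, t) * hpressure t - c ^ 2 * ρ₁ (L₁, t) * hmomentum t
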